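/- There exists a graph G whose connected tree-width is strictly greater than (the maximum connected order of a bramble of G) minus 1. More specifically, for every integer n ≥ 4 there is a graph G such that every bramble of G has connected order at most 5n + 3, while the connected tree-width of G is at least 6n. -/

import Mathlib

open SimpleGraph

universe u

/-- `x` and `y` are joined by a walk in `G` all of whose vertices lie in `S`. -/
def ConnIn {V : Type u} (G : SimpleGraph V) (S : Set V) (x y : V) : Prop :=
  ∃ p : G.Walk x y, ∀ v ∈ p.support, v ∈ S

/-- `S` is a (nonempty) connected vertex set of `G`, i.e. `G[S]` is connected. -/
def IsConnSet {V : Type u} (G : SimpleGraph V) (S : Set V) : Prop :=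
  S.Nonempty ∧ ∀ x ∈ S, ∀ y ∈ S, ConnIn G S x y

/-- A tree-decomposition of `G` over the tree `T`. -/
structure TreeDecomp {V ι : Type u} (G : SimpleGraph V) (T : SimpleGraph ι) where
  isTree : T.IsTree
  bag : ι → Set V
  exists_bag : ∀ v : V, ∃ t, v ∈ bag t
  exists_bag_adj : ∀ ⦃u v : V⦄, G.Adj u v → ∃ t, u ∈ bag t ∧ v ∈ bag t
  bag_sep : ∀ ⦃t₁ t₃ : ι⦄ (p : T.Walk t₁ t₃), p.IsPath → ∀ t₂ ∈ p.support,
      bag t₁ ∩ bag t₃ ⊆ bag t₂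

/-- The union of the bags `B u` over `u ∈ A`. -/
def unionBags {V ι : Type u} (B : ι → Set V) (A : Set ι) : Set V := ⋃ u ∈ A, B u

/-- `s` is a descendant of `t` in the tree `T` rooted at `r`:
`t` lies on the (unique) `r`–`s` path. -/
def Desc {ι : Type u} (T : SimpleGraph ι) (r t s : ι) : Prop :=
  ∃ p : T.Walk r s, p.IsPath ∧ t ∈ p.support

/-- The set of descendants of `t` (the subtree `T_t`). -/
def descSet {ι : Type u} (T : SimpleGraph ι) (r t : ι) : Set ι := {s | Desc T r t s}

/-- `s` is a child of `t` in the tree `T` rooted at `r`. -/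
def IsChild {ι : Type u} (T : SimpleGraph ι) (r t s : ι) : Prop :=
  T.Adj t s ∧ Desc T r t s

/-- The vertex set of the component of `t₁` in `T` minus the edge `t₁t₂`. -/
def Side {ι : Type u} (T : SimpleGraph ι) (t₁ t₂ : ι) : Set ι :=
  {u | ∃ p : T.Walk u t₁, p.IsPath ∧ t₂ ∉ p.support}

/-- The family of bags `B` is stable: for every tree edge `t₁t₂`, both sides
induce connected subgraphs of `G`. -/
def StableBags {V ι : Type u} (G : SimpleGraph V) (T : SimpleGraph ι) (B : ι → Set V) : Prop :=
  ∀ ⦃t₁ t₂ : ι⦄, T.Adj t₁ t₂ → IsConnSet G (unionBags B (Side T t₁ t₂))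

def TreeDecomp.Stable {V ι : Type u} {G : SimpleGraph V} {T : SimpleGraph ι}
    (td : TreeDecomp G T) : Prop :=
  StableBags G T td.bag

/-- `P` is a `t`-admissible path (w.r.t. the root `r` and bags `B`): a shortest
path lying in `V_{T_t}` joining two distinct components of `G[B t]`. -/
structure IsAdmissible {V ι : Type u} (G : SimpleGraph V) (T : SimpleGraph ι)
    (B : ι → Set V) (r t : ι) {x y : V} (P : G.Walk x y) : Prop where
  isPath : P.IsPath
  support_sub : ∀ v ∈ P.support, v ∈ unionBags B (descSet T r t)
  fst_mem : x ∈ B t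
  snd_mem : y ∈ B t
  not_conn : ¬ ConnIn G (B t) x y
  minimal : ∀ ⦃x' y' : V⦄ (Q : G.Walk x' y'), Q.IsPath →
      (∀ v ∈ Q.support, v ∈ unionBags B (descSet T r t)) →
      x' ∈ B t → y' ∈ B t → ¬ ConnIn G (B t) x' y' → P.length ≤ Q.length

/-- The updated bags obtained by adding the path `P` as in `(*)`:
`W_u = V_u ∪ (V(P) ∩ V_{T_u})` for descendants `u` of `t`, and `W_u = V_u` otherwise. -/
def updatedBag {V ι : Type u} (T : SimpleGraph ι) (B : ι → Set V) (r t : ι)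
    {G : SimpleGraph V} {x y : V} (P : G.Walk x y) (u : ι) : Set V :=
  B u ∪ {v | Desc T r t u ∧ v ∈ P.support ∧ v ∈ unionBags B (descSet T r u)}

/-- The tree-width of `G`: the least `k` such that `G` has a tree-decomposition
all of whose bags have at most `k + 1` vertices. -/
noncomputable def treewidth {V : Type u} (G : SimpleGraph V) : ℕ :=
  sInf {k | ∃ (ι : Type u) (T : SimpleGraph ι) (td : TreeDecomp G T),
    ∀ t, (td.bag t).ncard ≤ k + 1}

/-- A tree-decomposition is connected if every bag is a connected vertex set. -/
def TreeDecomp.IsConn {V ι : Type u} {G : SimpleGraph V} {T : SimpleGraph ι}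
    (td : TreeDecomp G T) : Prop :=
  ∀ t, IsConnSet G (td.bag t)

/-- The connected tree-width of `G`. -/
noncomputable def ctw {V : Type u} (G : SimpleGraph V) : ℕ :=
  sInf {k | ∃ (ι : Type u) (T : SimpleGraph ι) (td : TreeDecomp G T),
    td.IsConn ∧ ∀ t, (td.bag t).ncard ≤ k + 1}

/-- The weak connected tree-width of `G`: the least `k` such that `G` has a
tree-decomposition each of whose bags is contained in a connected set of at
most `k + 1` vertices. -/
noncomputable def wctw {V : Type u} (G : SimpleGraph V) : ℕ :=
  sInf {k | ∃ (ι : Type u) (T : SimpleGraph ι) (td : TreeDecomp G T),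
    ∀ t, ∃ X, td.bag t ⊆ X ∧ IsConnSet G X ∧ X.ncard ≤ k + 1}

/-- The characteristic vector over GF(2) of the edge set of a walk. -/
noncomputable def walkChar {V : Type u} {G : SimpleGraph V} {x y : V}
    (p : G.Walk x y) : Sym2 V → ZMod 2 :=
  fun e => by classical exact if e ∈ p.edges then 1 else 0

/-- The characteristic vectors of the cycles of `G` of length at most `ℓ`. -/
def cycleChars {V : Type u} (G : SimpleGraph V) (ℓ : ℕ) : Set (Sym2 V → ZMod 2) :=
  {f | ∃ (v : V) (p : G.Walk v v), p.IsCycle ∧ p.length ≤ ℓ ∧ f = walkChar p}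

/-- The cycles of length at most `ℓ` generate the cycle space of `G` over GF(2). -/
def GeneratesLE {V : Type u} (G : SimpleGraph V) (ℓ : ℕ) : Prop :=
  ∀ ⦃v : V⦄ (p : G.Walk v v), p.IsCycle →
    walkChar p ∈ Submodule.span (ZMod 2) (cycleChars G ℓ)

/-- `ℓ(G)`: the least `ℓ` such that the cycles of length at most `ℓ`
generate the cycle space of `G`. -/
noncomputable def ellGraph {V : Type u} (G : SimpleGraph V) : ℕ :=
  sInf {ℓ | GeneratesLE G ℓ}

/-- `Γ` is a set of cycles of `G` generating its cycle space over GF(2). -/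
def GeneratesSet {V : Type u} (G : SimpleGraph V) (Γ : Set (Σ v : V, G.Walk v v)) : Prop :=
  (∀ c ∈ Γ, c.2.IsCycle) ∧
  ∀ ⦃v : V⦄ (p : G.Walk v v), p.IsCycle →
    walkChar p ∈ Submodule.span (ZMod 2) {f | ∃ c ∈ Γ, f = walkChar c.2}

/-- A bramble: a collection of connected vertex sets, any two of which have
connected union. -/
def IsBramble {V : Type u} (G : SimpleGraph V) (B : Set (Set V)) : Prop :=
  (∀ S ∈ B, IsConnSet G S) ∧ ∀ S ∈ B, ∀ S' ∈ B, IsConnSet G (S ∪ S')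

/-- `X` is a connected cover of the bramble `B`. -/
def IsConnCover {V : Type u} (G : SimpleGraph V) (B : Set (Set V)) (X : Set V) : Prop :=
  IsConnSet G X ∧ ∀ S ∈ B, (X ∩ S).Nonempty

/-- The connected order of a bramble: the least size of a connected cover. -/
noncomputable def connOrder {V : Type u} (G : SimpleGraph V) (B : Set (Set V)) : ℕ :=
  sInf {n | ∃ X, IsConnCover G B X ∧ X.ncard = n}

/-- The maximum connected order of a bramble of `G`. -/
noncomputable def cbn {V : Type u} (G : SimpleGraph V) : ℕ :=
  sSup {n | ∃ B, IsBramble G B ∧ connOrder G B = n}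

/-- A geodesic cycle: a cycle containing a shortest `G`-path between any two
of its vertices. -/
def IsGeodesicCycle {V : Type u} (G : SimpleGraph V) {v : V} (p : G.Walk v v) : Prop :=
  p.IsCycle ∧ ∀ x ∈ p.support, ∀ y ∈ p.support,
    ∃ q : G.Walk x y, q.length = G.dist x y ∧ ∀ e ∈ q.edges, e ∈ p.edges

/-- The graph obtained from `K_n` by subdividing every edge exactly `k` times:
the edge between `i < j` is replaced by the path
`i, ((i,j),0), ((i,j),1), …, ((i,j),k-1), j`. -/
def subK (n k : ℕ) : SimpleGraph (Fin n ⊕ ({p : Fin n × Fin n // p.1 < p.2} × Fin k)) :=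
  SimpleGraph.fromRel fun u v =>
    match u, v with
    | Sum.inl i, Sum.inl j => i < j ∧ k = 0
    | Sum.inl i, Sum.inr (e, c) =>
        (e.val.1 = i ∧ (c : ℕ) = 0) ∨ (e.val.2 = i ∧ (c : ℕ) = k - 1)
    | Sum.inr (e, c), Sum.inr (e', c') => e = e' ∧ (c' : ℕ) = (c : ℕ) + 1
    | _, _ => False

/-- A set of tree vertices containing every path between two of its members. -/
def PathConvex {ι : Type u} (T : SimpleGraph ι) (C : Set ι) : Prop :=
  ∀ ⦃a b : ι⦄ (p : T.Walk a b), p.IsPath → a ∈ C → b ∈ C → ∀ c ∈ p.support, c ∈ C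

theorem PathConvex.inter {ι : Type u} {T : SimpleGraph ι} {C D : Set ι}
    (hC : PathConvex T C) (hD : PathConvex T D) : PathConvex T (C ∩ D) :=
  fun _ _ p hp ha hb c hc => ⟨hC p hp ha.1 hb.1 c hc, hD p hp ha.2 hb.2 c hc⟩

theorem exists_isPath_meeting_once {ι : Type u} {T : SimpleGraph ι} (S : Set ι) {z x : ι}
    (q : T.Walk z x) (hx : x ∈ S) :
    ∃ m ∈ S, ∃ r : T.Walk z m, r.IsPath ∧ ∀ v ∈ r.support, v ∈ S → v = m := by
  classical
  suffices ∃ m ∈ S, ∃ r : T.Walk z m, ∀ v ∈ r.support, v ∈ S → v = m by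
    obtain ⟨m, hm, r, hr⟩ := this
    exact ⟨m, hm, r.bypass, r.bypass_isPath,
      fun v hv => hr v (r.support_bypass_subset_support hv)⟩
  induction q with
  | nil => exact ⟨_, hx, .nil, by simp⟩
  | @cons u v w h q ih =>
    by_cases hu : u ∈ S
    · exact ⟨u, hu, .nil, by simp⟩
    · obtain ⟨m, hm, r, hr⟩ := ih hx
      refine ⟨m, hm, .cons h r, fun a ha haS => ?_⟩
      rcases List.mem_cons.1 (Walk.support_cons h r ▸ ha) with rfl | ha
      · exact absurd haS hu
      · exact hr a ha haS

theorem isPath_append_of_inter {ι : Type u} {T : SimpleGraph ι} {x y z : ι}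
    {p : T.Walk x y} {q : T.Walk y z} (hp : p.IsPath) (hq : q.IsPath)
    (h : ∀ v ∈ p.support, v ∈ q.support → v = y) : (p.append q).IsPath := by
  rw [Walk.isPath_def, Walk.support_append, List.nodup_append]
  rw [Walk.isPath_def] at hp hq
  refine ⟨hp, hq.tail, fun a ha b hb hab => ?_⟩
  subst hab
  have := h a ha (List.mem_of_mem_tail hb)
  subst this
  rw [← Walk.cons_tail_support q] at hq
  exact (List.nodup_cons.1 hq).1 hb

theorem PathConvex.exists_mem_three {ι : Type u} {T : SimpleGraph ι} (hT : T.Preconnected)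
    {C D F : Set ι} (hC : PathConvex T C) (hD : PathConvex T D) (hF : PathConvex T F)
    (hCD : (C ∩ D).Nonempty) (hCF : (C ∩ F).Nonempty) (hDF : (D ∩ F).Nonempty) :
    (C ∩ D ∩ F).Nonempty := by
  classical
  obtain ⟨x, hxC, hxD⟩ := hCD
  obtain ⟨y, hyC, hyF⟩ := hCF
  obtain ⟨z, hzD, hzF⟩ := hDF
  obtain ⟨p, hp⟩ := (hT x y).exists_isPath
  obtain ⟨q⟩ := hT z x
  obtain ⟨m, hm, r, hr, hrm⟩ :=
    exists_isPath_meeting_once {v | v ∈ p.support} q p.start_mem_support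
  have hm' : m ∈ p.support := hm
  refine ⟨m, ⟨hC p hp hxC hyC m hm, ?_⟩, ?_⟩
  · have hs : ∀ v ∈ (p.takeUntil m hm').reverse.support, v ∈ p.support := fun v hv =>
      p.support_takeUntil_subset_support hm' (by simpa using hv)
    exact hD _ (isPath_append_of_inter hr (hp.takeUntil hm').reverse
      fun v hv hv' => hrm v hv (hs v hv')) hzD hxD m
      ((Walk.mem_support_append_iff _ _).2 (Or.inl r.end_mem_support))
  · have hs : ∀ v ∈ (p.dropUntil m hm').support, v ∈ p.support := fun v hv =>
      p.support_dropUntil_subset_support hm' hv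
    exact hF _ (isPath_append_of_inter hr (hp.dropUntil hm')
      fun v hv hv' => hrm v hv (hs v hv')) hzF hyF m
      ((Walk.mem_support_append_iff _ _).2 (Or.inl r.end_mem_support))

/-- The Helly property of subtrees of a tree. -/
theorem PathConvex.exists_mem_forall {ι κ : Type*} {T : SimpleGraph ι} (hT : T.Connected)
    (s : Finset κ) (C : κ → Set ι) (hC : ∀ i ∈ s, PathConvex T (C i))
    (hne : ∀ i ∈ s, ∀ j ∈ s, (C i ∩ C j).Nonempty) : ∃ t, ∀ i ∈ s, t ∈ C i := by
  classical
  induction s using Finset.induction_on generalizing C with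
  | empty => exact ⟨hT.nonempty.some, by simp⟩
  | insert k s hk ih =>
    have hks := Finset.mem_insert_self k s
    have hs : ∀ {i}, i ∈ s → i ∈ insert k s := Finset.mem_insert_of_mem
    rcases s.eq_empty_or_nonempty with rfl | ⟨i₀, hi₀⟩
    · obtain ⟨t, ht⟩ := hne k hks k hks
      exact ⟨t, by simpa using ht.1⟩
    obtain ⟨t, ht⟩ := ih (fun i => C i ∩ C k) (fun i hi => (hC i (hs hi)).inter (hC k hks))
      (fun i hi j hj => by
        obtain ⟨t, ⟨h1, h2⟩, h3⟩ := PathConvex.exists_mem_three hT.preconnected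
          (hC i (hs hi)) (hC j (hs hj)) (hC k hks) (hne i (hs hi) j (hs hj))
          (hne i (hs hi) k hks) (hne j (hs hj) k hks)
        exact ⟨t, ⟨h1, h3⟩, h2, h3⟩)
    refine ⟨t, fun i hi => ?_⟩
    rcases Finset.mem_insert.1 hi with rfl | hi
    · exact (ht i₀ hi₀).2
    · exact (ht i hi).1

theorem ConnIn.refl {V : Type u} {G : SimpleGraph V} {S : Set V} {x : V} (hx : x ∈ S) :
    ConnIn G S x x :=
  ⟨.nil, by simpa using hx⟩

theorem ConnIn.symm {V : Type u} {G : SimpleGraph V} {S : Set V} {x y : V}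
    (h : ConnIn G S x y) : ConnIn G S y x := by
  obtain ⟨p, hp⟩ := h
  exact ⟨p.reverse, by simpa using hp⟩

theorem ConnIn.trans {V : Type u} {G : SimpleGraph V} {S : Set V} {x y z : V}
    (h : ConnIn G S x y) (h' : ConnIn G S y z) : ConnIn G S x z := by
  obtain ⟨p, hp⟩ := h
  obtain ⟨q, hq⟩ := h'
  exact ⟨p.append q, fun v hv =>
    ((Walk.mem_support_append_iff _ _).1 hv).elim (hp v) (hq v)⟩

theorem ConnIn.of_adj {V : Type u} {G : SimpleGraph V} {S : Set V} {x y : V}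
    (h : G.Adj x y) (hx : x ∈ S) (hy : y ∈ S) : ConnIn G S x y :=
  ⟨.cons h .nil, by simp [hx, hy]⟩

/-- A property preserved along edges inside a connected set holds on all of it if it holds
somewhere. -/
theorem IsConnSet.induction {V : Type u} {G : SimpleGraph V} {S : Set V} (hS : IsConnSet G S)
    {P : V → Prop} (hP : ∀ u ∈ S, ∀ v ∈ S, G.Adj u v → P u → P v) {x y : V}
    (hx : x ∈ S) (hy : y ∈ S) (h : P x) : P y := by
  obtain ⟨p, hp⟩ := hS.2 x hx y hy
  clear hx hy
  induction p with
  | nil => exact h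
  | cons hadj p ih =>
    simp only [Walk.support_cons, List.mem_cons, forall_eq_or_imp] at hp
    exact ih (hP _ hp.1 _ (hp.2 _ p.start_mem_support) hadj h) hp.2

theorem TreeDecomp.pathConvex_mem {V ι : Type u} {G : SimpleGraph V} {T : SimpleGraph ι}
    (td : TreeDecomp G T) (v : V) : PathConvex T {t | v ∈ td.bag t} :=
  fun _ _ p hp ha hb _ hc => td.bag_sep p hp _ hc ⟨ha, hb⟩

/-- The tree vertices whose bags meet a given connected set form a subtree. -/
theorem TreeDecomp.pathConvex_inter_nonempty {V ι : Type u} {G : SimpleGraph V}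
    {T : SimpleGraph ι} (td : TreeDecomp G T) {S : Set V} (hS : IsConnSet G S) :
    PathConvex T {t | (td.bag t ∩ S).Nonempty} := by
  classical
  rintro a b p hp ⟨u, hua, huS⟩ ⟨v, hvb, hvS⟩ c hc
  by_contra hcS
  have hcS : ∀ w ∈ S, w ∉ td.bag c := fun w hw hwc => hcS ⟨w, hwc, hw⟩
  have extend : ∀ w ∈ S, ∀ s s', w ∈ td.bag s → w ∈ td.bag s' →
      ConnIn T {c}ᶜ a s → ConnIn T {c}ᶜ a s' := by
    intro w hw s s' hs hs' h
    obtain ⟨q, hq⟩ := (td.isTree.connected.preconnected s s').exists_isPath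
    refine h.trans ⟨q, fun t ht htc => hcS w hw ?_⟩
    rw [← Set.mem_singleton_iff.1 htc]
    exact td.bag_sep q hq t ht ⟨hs, hs'⟩
  have key : ∃ s, v ∈ td.bag s ∧ ConnIn T {c}ᶜ a s := by
    refine hS.induction (P := fun w => ∃ s, w ∈ td.bag s ∧ ConnIn T {c}ᶜ a s) ?_ huS hvS
      ⟨a, hua, .refl fun h => hcS u huS (h ▸ hua)⟩
    rintro x hx y hy hxy ⟨s, hs, hs'⟩
    obtain ⟨t, hxt, hyt⟩ := td.exists_bag_adj hxy
    exact ⟨t, hyt, extend x hx s t hs hxt hs'⟩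
  obtain ⟨s, hs, has⟩ := key
  obtain ⟨q, hq⟩ := extend v hvS s b hs hvb has
  have := (td.isTree.isAcyclic.subsingleton_path a b).elim ⟨p, hp⟩ ⟨q.bypass, q.bypass_isPath⟩
  have hpq : p = q.bypass := congrArg Subtype.val this
  exact hq c (q.support_bypass_subset_support (hpq ▸ hc)) rfl

/-- A multigraph with vertex set `A`, edge set `E`, and a positive length for every edge. -/
structure LengthMultigraph (A E : Type) where
  src : E → A
  tgt : E → A
  len : E → ℕ
  len_pos : ∀ e, 0 < len e

namespace LengthMultigraph

variable {A E : Type} (M : LengthMultigraph A E)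

/-- The branch vertices and the inner vertices of the subdivided edges. -/
abbrev Vertex : Type := A ⊕ (Σ e : E, Fin (M.len e - 1))

/-- The `i`-th vertex on the path replacing the edge `e`. -/
def pt (e : E) (i : ℕ) : M.Vertex :=
  if i = 0 then Sum.inl (M.src e)
  else if h : i - 1 < M.len e - 1 then Sum.inr ⟨e, ⟨i - 1, h⟩⟩
  else Sum.inl (M.tgt e)

/-- The graph obtained by replacing every edge by a path of the prescribed length. -/
def subdivision : SimpleGraph M.Vertex :=
  SimpleGraph.fromRel fun u v => ∃ e i, i < M.len e ∧ u = M.pt e i ∧ v = M.pt e (i + 1)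

@[simp] theorem pt_zero (e : E) : M.pt e 0 = Sum.inl (M.src e) := by simp [pt]

@[simp] theorem pt_len (e : E) : M.pt e (M.len e) = Sum.inl (M.tgt e) := by
  have := M.len_pos e
  simp [pt, this.ne']

theorem pt_succ (e : E) (k : Fin (M.len e - 1)) : M.pt e (k + 1) = Sum.inr ⟨e, k⟩ := by
  simp [pt]

theorem exists_eq_pt (x : Σ e : E, Fin (M.len e - 1)) :
    ∃ i, 0 < i ∧ i < M.len x.1 ∧ M.pt x.1 i = Sum.inr x :=
  ⟨x.2 + 1, by omega, by have := x.2.2; omega, M.pt_succ x.1 x.2⟩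

theorem pt_of_lt {e : E} {i : ℕ} (h0 : 0 < i) (hi : i < M.len e) :
    M.pt e i = Sum.inr ⟨e, ⟨i - 1, by omega⟩⟩ := by
  rw [pt, if_neg h0.ne', dif_pos (by omega)]

/-- The edge `e` is full in `S` if the whole path replacing it lies in `S`. -/
def Full (S : Set M.Vertex) (e : E) : Prop := ∀ i ≤ M.len e, M.pt e i ∈ S

variable {M}

theorem Full.src_mem {S : Set M.Vertex} {e : E} (h : M.Full S e) : Sum.inl (M.src e) ∈ S :=
  M.pt_zero e ▸ h 0 (Nat.zero_le _)

theorem Full.tgt_mem {S : Set M.Vertex} {e : E} (h : M.Full S e) : Sum.inl (M.tgt e) ∈ S :=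
  M.pt_len e ▸ h _ le_rfl

theorem Full.inner_mem {S : Set M.Vertex} {e : E} (h : M.Full S e) (k : Fin (M.len e - 1)) :
    Sum.inr ⟨e, k⟩ ∈ S :=
  M.pt_succ e k ▸ h _ (by omega)

/-- To check that a function on vertices is constant on a connected set, it suffices to look at
consecutive vertices on the subdivided edges. -/
theorem eq_of_isConnSet {α : Type*} {S : Set M.Vertex} (hS : IsConnSet M.subdivision S)
    {g : M.Vertex → α}
    (hg : ∀ e i, i < M.len e → M.pt e i ∈ S → M.pt e (i + 1) ∈ S →
      g (M.pt e i) = g (M.pt e (i + 1))) {x y : M.Vertex} (hx : x ∈ S) (hy : y ∈ S) :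
    g x = g y := by
  refine hS.induction (P := fun v => g x = g v) ?_ hx hy rfl
  intro u hu v hv hadj h
  rcases hadj.2 with ⟨e, i, hi, rfl, rfl⟩ | ⟨e, i, hi, rfl, rfl⟩
  · exact h.trans (hg e i hi hu hv)
  · exact h.trans (hg e i hi hv hu).symm

/-- A connected set of the subdivision meets only one side of a cut none of whose edges is full
in the set. -/
theorem cut_iff {S : Set M.Vertex} (hS : IsConnSet M.subdivision S) (f : A → Prop)
    (hf : ∀ e, M.Full S e → (f (M.src e) ↔ f (M.tgt e))) {a b : A}
    (ha : Sum.inl a ∈ S) (hb : Sum.inl b ∈ S) : f a ↔ f b := by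
  classical
  let g : M.Vertex → Prop := Sum.elim f fun x =>
    if ∃ m ≤ x.2.1, M.pt x.1 m ∉ S then f (M.tgt x.1) else f (M.src x.1)
  have hg : ∀ e i, i ≤ M.len e → M.pt e i ∈ S →
      (g (M.pt e i) ↔ if ∃ m < i, M.pt e m ∉ S then f (M.tgt e) else f (M.src e)) := by
    intro e i hi hiS
    rcases Nat.eq_zero_or_pos i with rfl | h0
    · simp [g]
    rcases hi.lt_or_eq with hlt | rfl
    · rw [M.pt_of_lt h0 hlt]
      have : ∀ m, m ≤ i - 1 ↔ m < i := fun m => by omega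
      simp only [g, Sum.elim_inr, this]
    · by_cases h : ∃ m < M.len e, M.pt e m ∉ S
      · simp [g, h]
      · rw [if_neg h]
        push Not at h
        simpa [g] using (hf e fun m hm => hm.lt_or_eq.elim (h m) fun h' => h' ▸ hiS).symm
  have := eq_of_isConnSet (g := g) hS (fun e i hi h1 h2 => ?_) ha hb
  · simpa [g] using this
  · rw [propext (hg e i hi.le h1), propext (hg e (i + 1) hi h2)]
    have : (∃ m < i, M.pt e m ∉ S) ↔ ∃ m < i + 1, M.pt e m ∉ S := by
      refine ⟨fun ⟨m, hm, h⟩ => ⟨m, by omega, h⟩, fun ⟨m, hm, h⟩ => ⟨m, ?_, h⟩⟩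
      rcases Nat.lt_succ_iff_lt_or_eq.1 hm with h' | rfl
      · exact h'
      · exact absurd h1 h
    simp only [this]

theorem exists_full_of_cut {S : Set M.Vertex} (hS : IsConnSet M.subdivision S) (f : A → Prop)
    {a b : A} (ha : Sum.inl a ∈ S) (hb : Sum.inl b ∈ S) (hfa : f a) (hfb : ¬ f b) :
    ∃ e, M.Full S e ∧ ¬ (f (M.src e) ↔ f (M.tgt e)) := by
  by_contra! h
  exact hfb ((cut_iff hS f h ha hb).1 hfa)

/-- A connected set without branch vertices lies inside a single subdivided edge. -/
theorem exists_edge_of_no_branch {S : Set M.Vertex} (hS : IsConnSet M.subdivision S)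
    (h : ∀ a, Sum.inl a ∉ S) : ∃ e, ∀ x ∈ S, ∃ k, x = Sum.inr ⟨e, k⟩ := by
  obtain ⟨x₀, hx₀⟩ := hS.1
  rcases x₀ with a | ⟨e, k⟩
  · exact absurd hx₀ (h a)
  refine ⟨e, fun x hx => ?_⟩
  let g : M.Vertex → Option E := Sum.elim (fun _ => none) fun x => some x.1
  have hmem : ∀ e i, i ≤ M.len e → M.pt e i ∈ S → g (M.pt e i) = some e := by
    intro e i hi hiS
    rcases Nat.eq_zero_or_pos i with rfl | h0
    · exact absurd (M.pt_zero e ▸ hiS) (h _)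
    rcases hi.lt_or_eq with hlt | rfl
    · rw [M.pt_of_lt h0 hlt]
      rfl
    · exact absurd (M.pt_len e ▸ hiS) (h _)
  have := eq_of_isConnSet (g := g) hS
    (fun e i hi h1 h2 => (hmem e i hi.le h1).trans (hmem e (i + 1) hi h2).symm) hx hx₀
  rcases x with a | ⟨e', k'⟩
  · exact absurd hx (h a)
  · obtain rfl : e' = e := by simpa [g] using this
    exact ⟨k', rfl⟩

theorem connIn_pt {S : Set M.Vertex} {e : E} {j : ℕ} (hj : j ≤ M.len e)
    (h : ∀ i ≤ j, M.pt e i ∈ S) : ConnIn M.subdivision S (M.pt e 0) (M.pt e j) := by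
  induction j with
  | zero => exact .refl (h 0 le_rfl)
  | succ j ih =>
    refine (ih (by omega) fun i hi => h i (by omega)).trans ?_
    by_cases hne : M.pt e j = M.pt e (j + 1)
    · rw [← hne]
      exact .refl (h j (by omega))
    · exact .of_adj ⟨hne, Or.inl ⟨e, j, hj, rfl, rfl⟩⟩ (h j (by omega)) (h _ le_rfl)

theorem isConnSet_initial (e : E) {l : ℕ} (hl : l ≤ M.len e) :
    IsConnSet M.subdivision {x | ∃ i ≤ l, x = M.pt e i} := by
  have key : ∀ i ≤ l, ConnIn M.subdivision {x | ∃ i ≤ l, x = M.pt e i} (M.pt e 0) (M.pt e i) :=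
    fun i hi => connIn_pt (hi.trans hl) fun m hm => ⟨m, hm.trans hi, rfl⟩
  refine ⟨⟨M.pt e 0, 0, Nat.zero_le _, rfl⟩, ?_⟩
  rintro x ⟨i, hi, rfl⟩ y ⟨j, hj, rfl⟩
  exact (key i hi).symm.trans (key j hj)

variable (M) in
/-- The branch vertices in `A'` together with the inner vertices of the edges in `E'`. -/
def span (A' : Finset A) (E' : Finset E) : Finset M.Vertex :=
  A'.disjSum (E'.sigma fun _ => Finset.univ)

@[simp] theorem inl_mem_span {A' : Finset A} {E' : Finset E} {a : A} :
    (Sum.inl a : M.Vertex) ∈ M.span A' E' ↔ a ∈ A' := by simp [span]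

@[simp] theorem inr_mem_span {A' : Finset A} {E' : Finset E} {x : Σ e : E, Fin (M.len e - 1)} :
    (Sum.inr x : M.Vertex) ∈ M.span A' E' ↔ x.1 ∈ E' := by simp [span]

theorem card_span (A' : Finset A) (E' : Finset E) :
    (M.span A' E').card = A'.card + ∑ e ∈ E', (M.len e - 1) := by
  simp [span]

theorem card_span_le_ncard [Finite A] [Finite E] {S : Set M.Vertex} {A' : Finset A}
    {E' : Finset E} (hA : ∀ a ∈ A', Sum.inl a ∈ S) (hE : ∀ e ∈ E', M.Full S e) :
    A'.card + ∑ e ∈ E', (M.len e - 1) ≤ S.ncard := by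
  rw [← card_span, ← Set.ncard_coe_finset]
  refine Set.ncard_le_ncard ?_ (Set.toFinite S)
  rintro (a | ⟨e, k⟩) hx
  · exact hA a (inl_mem_span.1 hx)
  · exact (hE e (inr_mem_span.1 hx)).inner_mem k

theorem full_span {A' : Finset A} {E' : Finset E} {e : E} (he : e ∈ E') (hs : M.src e ∈ A')
    (ht : M.tgt e ∈ A') : M.Full (M.span A' E' : Set M.Vertex) e := by
  intro i hi
  rcases Nat.eq_zero_or_pos i with rfl | h0
  · simpa using hs
  rcases hi.lt_or_eq with hlt | rfl
  · rw [M.pt_of_lt h0 hlt]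
    simpa using he
  · simpa using ht

/-- The span of a connected sub-multigraph is connected. -/
theorem isConnSet_span {A' : Finset A} {E' : Finset E} (hs : ∀ e ∈ E', M.src e ∈ A')
    (ht : ∀ e ∈ E', M.tgt e ∈ A') {r : A} (hr : r ∈ A')
    (hconn : ∀ P : A → Prop, P r → (∀ e ∈ E', P (M.src e) ↔ P (M.tgt e)) → ∀ a ∈ A', P a) :
    IsConnSet M.subdivision (M.span A' E' : Set M.Vertex) := by
  have hfull : ∀ e ∈ E', M.Full (M.span A' E' : Set M.Vertex) e := fun e he =>
    full_span he (hs e he) (ht e he)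
  have hbranch : ∀ a ∈ A',
      ConnIn M.subdivision (M.span A' E' : Set M.Vertex) (Sum.inl r) (Sum.inl a) := by
    refine hconn _ (.refl (by simpa using hr)) fun e he => ?_
    have := connIn_pt le_rfl (hfull e he)
    rw [pt_zero, pt_len] at this
    exact ⟨fun h => h.trans this, fun h => h.trans this.symm⟩
  have key : ∀ x ∈ (M.span A' E' : Set M.Vertex),
      ConnIn M.subdivision (M.span A' E' : Set M.Vertex) (Sum.inl r) x := by
    rintro (a | x) hx
    · exact hbranch a (inl_mem_span.1 hx)
    · have hxE : x.1 ∈ E' := inr_mem_span.1 hx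
      obtain ⟨i, -, hi, hix⟩ := M.exists_eq_pt x
      have := connIn_pt hi.le fun m hm => hfull x.1 hxE m (hm.trans hi.le)
      rw [pt_zero, hix] at this
      exact (hbranch _ (hs _ hxE)).trans this
  exact ⟨⟨Sum.inl r, by simpa using hr⟩, fun x hx y hy => (key x hx).symm.trans (key y hy)⟩

/-- If some member of a bramble lies inside a subdivided edge, then the path replacing this edge
covers the bramble. -/
theorem isConnCover_of_subset_edge {B : Set (Set M.Vertex)} (hB : IsBramble M.subdivision B)
    {S : Set M.Vertex} (hS : S ∈ B) {e : E} (hSe : ∀ x ∈ S, ∃ k, x = Sum.inr ⟨e, k⟩) :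
    IsConnCover M.subdivision B {x | ∃ i ≤ M.len e, x = M.pt e i} := by
  classical
  refine ⟨isConnSet_initial e le_rfl, fun S' hS' => ?_⟩
  by_contra hcon
  have hcon : ∀ i ≤ M.len e, M.pt e i ∉ S' := fun i hi h => hcon ⟨_, ⟨i, hi, rfl⟩, h⟩
  obtain ⟨x, hx⟩ := (hB.1 S hS).1
  obtain ⟨y, hy⟩ := (hB.1 S' hS').1
  have hinner : ∀ k, (Sum.inr ⟨e, k⟩ : M.Vertex) ∉ S' := fun k h =>
    hcon (k + 1) (by omega) (by rwa [pt_succ])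
  have hend : ∀ a, (a = M.src e ∨ a = M.tgt e) → (Sum.inl a : M.Vertex) ∉ S ∪ S' := by
    rintro a ha (h | h)
    · obtain ⟨k, hk⟩ := hSe _ h
      simp at hk
    · rcases ha with rfl | rfl
      · exact hcon 0 (Nat.zero_le _) (by simpa using h)
      · exact hcon _ le_rfl (by simpa using h)
  let g : M.Vertex → Prop := fun x => ∃ k, x = Sum.inr ⟨e, k⟩
  have hg : ∀ e' i, i ≤ M.len e' → M.pt e' i ∈ S ∪ S' → (g (M.pt e' i) ↔ e' = e) := by
    intro e' i hi hiS
    rcases Nat.eq_zero_or_pos i with rfl | h0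
    · rw [pt_zero] at hiS ⊢
      simp only [g, reduceCtorEq, exists_false, false_iff]
      rintro rfl
      exact hend _ (Or.inl rfl) hiS
    rcases hi.lt_or_eq with hlt | rfl
    · rw [M.pt_of_lt h0 hlt]
      constructor
      · rintro ⟨k, hk⟩
        exact congrArg Sigma.fst (Sum.inr.inj hk)
      · rintro rfl
        exact ⟨_, rfl⟩
    · rw [pt_len] at hiS ⊢
      simp only [g, reduceCtorEq, exists_false, false_iff]
      rintro rfl
      exact hend _ (Or.inr rfl) hiS
  have := eq_of_isConnSet (g := g) (hB.2 S hS S' hS')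
    (fun e' i hi h1 h2 => propext ((hg e' i hi.le h1).trans (hg e' (i + 1) hi h2).symm))
    (Or.inl hx) (Or.inr hy)
  obtain ⟨k, rfl⟩ : g y := this ▸ hSe x hx
  exact hinner k hy

theorem ncard_edge_le (e : E) : {x | ∃ i ≤ M.len e, x = M.pt e i}.ncard ≤ M.len e + 1 := by
  classical
  have : {x | ∃ i ≤ M.len e, x = M.pt e i} =
      ((Finset.range (M.len e + 1)).image (M.pt e) : Set M.Vertex) := by
    ext x
    simp [eq_comm]
  rw [this, Set.ncard_coe_finset]
  exact Finset.card_image_le.trans (by simp)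

/-- If more edges than the size of any bag join `a` to `b`, then some bag contains both. -/
theorem exists_bag_of_parallel [Finite A] [Finite E] {ι : Type} {T : SimpleGraph ι}
    (td : TreeDecomp M.subdivision T) {m : ℕ} (hm : ∀ t, (td.bag t).ncard ≤ m) {a b : A}
    {es : Fin (m + 1) → E} (hes : Function.Injective es) (hsrc : ∀ q, M.src (es q) = a)
    (htgt : ∀ q, M.tgt (es q) = b) : ∃ t, Sum.inl a ∈ td.bag t ∧ Sum.inl b ∈ td.bag t := by
  classical
  let P : Fin (m + 1) → Set M.Vertex := fun q => {x | ∃ i ≤ M.len (es q) - 1, x = M.pt (es q) i}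
  have hP : ∀ q, IsConnSet M.subdivision (P q) := fun q => isConnSet_initial _ (by omega)
  have haP : ∀ q, Sum.inl a ∈ P q := fun q => ⟨0, Nat.zero_le _, by simp [hsrc]⟩
  let C : Option (Fin (m + 1)) → Set ι := fun o =>
    o.elim {t | Sum.inl b ∈ td.bag t} fun q => {t | (td.bag t ∩ P q).Nonempty}
  have hbP : ∀ q, ∃ t, Sum.inl b ∈ td.bag t ∧ (td.bag t ∩ P q).Nonempty := by
    intro q
    have hlen := M.len_pos (es q)
    have hlast : M.pt (es q) (M.len (es q) - 1) ∈ P q := ⟨_, le_rfl, rfl⟩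
    by_cases h : M.pt (es q) (M.len (es q) - 1) = Sum.inl b
    · obtain ⟨t, ht⟩ := td.exists_bag (Sum.inl b)
      exact ⟨t, ht, _, ht, h ▸ hlast⟩
    · have hadj : M.subdivision.Adj (M.pt (es q) (M.len (es q) - 1)) (Sum.inl b) :=
        ⟨h, Or.inl ⟨es q, _, by omega, rfl, by
          rw [Nat.sub_add_cancel hlen, pt_len, htgt]⟩⟩
      obtain ⟨t, h1, h2⟩ := td.exists_bag_adj hadj
      exact ⟨t, h2, _, h1, hlast⟩
  obtain ⟨t, ht⟩ := PathConvex.exists_mem_forall td.isTree.connected Finset.univ C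
    (by
      rintro (_ | q) -
      · exact td.pathConvex_mem _
      · exact td.pathConvex_inter_nonempty (hP q))
    (by
      rintro (_ | q) - (_ | q') -
      · obtain ⟨t, ht⟩ := td.exists_bag (Sum.inl b)
        exact ⟨t, ht, ht⟩
      · obtain ⟨t, h1, h2⟩ := hbP q'
        exact ⟨t, h1, h2⟩
      · obtain ⟨t, h1, h2⟩ := hbP q
        exact ⟨t, h2, h1⟩
      · obtain ⟨t, ht⟩ := td.exists_bag (Sum.inl a)
        exact ⟨t, ⟨_, ht, haP q⟩, _, ht, haP q'⟩)
  refine ⟨t, by_contra fun hat => ?_, ht none (Finset.mem_univ _)⟩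
  choose x hx using fun q => ht (some q) (Finset.mem_univ _)
  have hxe : ∀ q, ∃ k, x q = Sum.inr ⟨es q, k⟩ := by
    intro q
    obtain ⟨hxt, i, hi, hxi⟩ := hx q
    have hlen := M.len_pos (es q)
    rcases Nat.eq_zero_or_pos i with rfl | h0
    · rw [hxi, pt_zero, hsrc] at hxt
      exact absurd hxt hat
    · exact ⟨_, hxi.trans (M.pt_of_lt h0 (by omega))⟩
  choose k hk using hxe
  have hinj : Function.Injective x := fun q q' h => by
    rw [hk, hk] at h
    exact hes (congrArg Sigma.fst (Sum.inr.inj h))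
  have := Set.ncard_le_ncard (Set.range_subset_iff.2 fun q => (hx q).1) (Set.toFinite (td.bag t))
  rw [Set.ncard_range_of_injective hinj, Nat.card_eq_fintype_card, Fintype.card_fin] at this
  exact absurd (hm t) (by omega)

end LengthMultigraph

/-- Branch vertices: the cycle vertices `Sum.inl i` and the pendant vertices `Sum.inr j`. -/
abbrev Branch : Type := Fin 6 ⊕ Fin 6

/-- The end on the cycle of the `i`-th bundle of long edges at a branch vertex. A pendant vertex
`Sum.inr j` sends long edges to every cycle vertex except `Sum.inl j`. -/
def farEnd : Branch → Fin 6 → Branch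
  | Sum.inl _, i => Sum.inl i
  | Sum.inr j, i => Sum.inl (if i = j then j + 3 else i)

/-- A cycle `w₀ … w₅` of length `6 * n + 1`, pendant vertices `z₀, …, z₅` with `z_j` joined to the
antipode of `w_j`, and bundles of long parallel edges from every branch vertex to every `w_i`,
except from `z_j` to `w_j`. -/
def bundledCycle (n : ℕ) (hn : 0 < n) :
    LengthMultigraph Branch (Branch ⊕ (Branch × Fin 6 × Fin (6 * n + 1))) where
  src
    | Sum.inl (Sum.inl i) => Sum.inl i
    | Sum.inl (Sum.inr j) => Sum.inr j
    | Sum.inr (a, _, _) => a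
  tgt
    | Sum.inl (Sum.inl i) => Sum.inl (i + 1)
    | Sum.inl (Sum.inr j) => Sum.inl (j + 3)
    | Sum.inr (a, i, _) => farEnd a i
  len
    | Sum.inl (Sum.inl i) => n + if i = 0 then 1 else 0
    | Sum.inl (Sum.inr _) => n
    | Sum.inr _ => 5 * n + 2
  len_pos := by
    rintro ((i | j) | e) <;> positivity

/-- The pendant vertex `z_j` and all cycle vertices except `w_j`. -/
def starBranch (j : Fin 6) : Finset Branch :=
  insert (Sum.inr j) ((Finset.univ.erase j).image Sum.inl)

theorem inl_mem_star {i j : Fin 6} : Sum.inl i ∈ starBranch j ↔ i ≠ j := by simp [starBranch]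

theorem inr_mem_star {i j : Fin 6} : Sum.inr i ∈ starBranch j ↔ i = j := by simp [starBranch]

theorem card_star (j : Fin 6) : (starBranch j).card = 6 := by decide +revert

/-- The edges of the cycle not incident with `w_j`, together with the edge at `z_j`. -/
def starEdges (n : ℕ) (j : Fin 6) : Finset (Branch ⊕ (Branch × Fin 6 × Fin (6 * n + 1))) :=
  insert (Sum.inl (Sum.inr j))
    ((Finset.univ.filter fun i : Fin 6 => i ≠ j ∧ i + 1 ≠ j).image fun i => Sum.inl (Sum.inl i))

section

open LengthMultigraph

variable {n : ℕ} {hn : 0 < n}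

theorem sub_one_le_len_sub_one (e) : n - 1 ≤ (bundledCycle n hn).len e - 1 := by
  rcases e with (i | j) | e <;> simp only [bundledCycle] <;> omega

theorem exists_mem_inl_of_isBramble {B : Set (Set (bundledCycle n hn).Vertex)}
    (hB : IsBramble (bundledCycle n hn).subdivision B)
    (hcover : ∀ X, IsConnCover (bundledCycle n hn).subdivision B X → 5 * n + 3 < X.ncard)
    {S : Set (bundledCycle n hn).Vertex} (hS : S ∈ B) : ∃ a, Sum.inl a ∈ S := by
  by_contra! h
  obtain ⟨e, he⟩ := exists_edge_of_no_branch (hB.1 S hS) h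
  have h1 := hcover _ (isConnCover_of_subset_edge hB hS he)
  have h2 := ncard_edge_le (M := bundledCycle n hn) e
  have h3 : (bundledCycle n hn).len e ≤ 5 * n + 2 := by
    rcases e with (i | j) | e
    · simp only [bundledCycle]
      split_ifs <;> omega
    · simp only [bundledCycle]
      omega
    · simp [bundledCycle]
  omega

theorem exists_mem_disjoint {B : Set (Set (bundledCycle n hn).Vertex)}
    (hcover : ∀ X, IsConnCover (bundledCycle n hn).subdivision B X → 5 * n + 3 < X.ncard)
    {X : Finset (bundledCycle n hn).Vertex}
    (hX : IsConnSet (bundledCycle n hn).subdivision (X : Set (bundledCycle n hn).Vertex))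
    (hcard : X.card ≤ 5 * n + 3) : ∃ S ∈ B, ∀ x ∈ X, x ∉ S := by
  by_contra! h
  have := hcover X ⟨hX, fun S hS => h S hS⟩
  rw [Set.ncard_coe_finset] at this
  omega

theorem isConnSet_span_cycle :
    IsConnSet (bundledCycle n hn).subdivision ((bundledCycle n hn).span
      (Finset.univ.image Sum.inl)
      ((Finset.univ.erase 0).image fun i => Sum.inl (Sum.inl i)) : Set _) := by
  refine isConnSet_span (r := Sum.inl 1) ?_ ?_ (by simp) ?_
  · simp [bundledCycle]
  · simp [bundledCycle]
  · intro P h1 hP a ha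
    have hP : ∀ i : Fin 6, i ≠ 0 → (P (Sum.inl i) ↔ P (Sum.inl (i + 1))) := fun i hi =>
      hP (Sum.inl (Sum.inl i)) (by simpa using hi)
    have h2 := hP 1 (by decide)
    have h3 := hP 2 (by decide)
    have h4 := hP 3 (by decide)
    have h5 := hP 4 (by decide)
    have h6 := hP 5 (by decide)
    simp only [Fin.reduceAdd] at h2 h3 h4 h5 h6
    obtain ⟨i, -, rfl⟩ := Finset.mem_image.1 ha
    fin_cases i <;> simp only [Fin.reduceFinMk, Fin.mk_one, Fin.zero_eta] <;> tauto

theorem card_span_cycle_le (h4 : 4 ≤ n) :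
    ((bundledCycle n hn).span (Finset.univ.image Sum.inl)
      ((Finset.univ.erase 0).image fun i => Sum.inl (Sum.inl i))).card ≤ 5 * n + 3 := by
  rw [card_span, Finset.sum_image (by simp), Finset.sum_congr rfl (g := fun _ => n - 1)]
  · rw [Finset.sum_const, Finset.card_image_of_injective _ Sum.inl_injective]
    simp
    omega
  · intro i hi
    simp [bundledCycle, Finset.ne_of_mem_erase hi]

theorem isConnSet_span_star (j : Fin 6) :
    IsConnSet (bundledCycle n hn).subdivision
      ((bundledCycle n hn).span (starBranch j) (starEdges n j) : Set _) := by
  refine isConnSet_span (r := Sum.inr j) ?_ ?_ (inr_mem_star.2 rfl) ?_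
  · simp only [starEdges, Finset.forall_mem_insert, Finset.forall_mem_image]
    exact ⟨inr_mem_star.2 rfl, fun i hi => inl_mem_star.2 (Finset.mem_filter.1 hi).2.1⟩
  · simp only [starEdges, Finset.forall_mem_insert, Finset.forall_mem_image]
    exact ⟨inl_mem_star.2 (by simp), fun i hi => inl_mem_star.2 (Finset.mem_filter.1 hi).2.2⟩
  · intro P h1 hP a ha
    have hleg : P (Sum.inr j) ↔ P (Sum.inl (j + 3)) :=
      hP (Sum.inl (Sum.inr j)) (by simp [starEdges])
    have hP : ∀ i : Fin 6, i ≠ j → i + 1 ≠ j → (P (Sum.inl i) ↔ P (Sum.inl (i + 1))) :=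
      fun i hi hi' => hP (Sum.inl (Sum.inl i)) (by simp [starEdges, hi, hi'])
    have h3 := hleg.1 h1
    have h4 := (hP (j + 3) (by simp) (by rw [add_assoc]; simp)).1 h3
    have h5 := (hP (j + 3 + 1) (by simp [add_assoc]) (by simp [add_assoc])).1 h4
    have h2 := (hP (j + 2) (by simp) (by simp [add_assoc])).2 (by simpa [add_assoc] using h3)
    have h1' := (hP (j + 1) (by simp) (by simp [add_assoc])).2 (by simpa [add_assoc] using h2)
    rcases a with i | i
    · have hi := inl_mem_star.1 ha
      have : i = j + 1 ∨ i = j + 2 ∨ i = j + 3 ∨ i = j + 3 + 1 ∨ i = j + 3 + 1 + 1 := by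
        clear * - hi
        decide +revert
      rcases this with rfl | rfl | rfl | rfl | rfl <;> assumption
    · rwa [inr_mem_star.1 ha]

theorem card_span_star_le (j : Fin 6) :
    ((bundledCycle n hn).span (starBranch j) (starEdges n j)).card ≤ 5 * n + 3 := by
  rw [card_span, card_star, starEdges, Finset.sum_insert (by simp), Finset.sum_image (by simp),
    Finset.sum_filter, Fin.sum_univ_six]
  fin_cases j <;> simp [bundledCycle] <;> omega

theorem exists_isConnCover (h4 : 4 ≤ n) {B : Set (Set (bundledCycle n hn).Vertex)}
    (hB : IsBramble (bundledCycle n hn).subdivision B) :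
    ∃ X, IsConnCover (bundledCycle n hn).subdivision B X ∧ X.ncard ≤ 5 * n + 3 := by
  by_contra! hcover
  obtain ⟨S, hS, hSX⟩ := exists_mem_disjoint hcover isConnSet_span_cycle (card_span_cycle_le h4)
  have hSw : ∀ i, Sum.inl (Sum.inl i) ∉ S := fun i => hSX _ (by simp)
  obtain ⟨i | j, hjS⟩ := exists_mem_inl_of_isBramble hB hcover hS
  · exact hSw i hjS
  obtain ⟨S', hS', hSX'⟩ :=
    exists_mem_disjoint hcover (isConnSet_span_star j) (card_span_star_le j)
  have hstar : ∀ a ∈ starBranch j, Sum.inl a ∉ S' := fun a ha => hSX' _ (inl_mem_span.2 ha)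
  obtain ⟨a, haS'⟩ := exists_mem_inl_of_isBramble hB hcover hS'
  have haj : a ≠ Sum.inr j := by
    rintro rfl
    exact hstar _ (inr_mem_star.2 rfl) haS'
  have hw : ∀ i, i ≠ j → Sum.inl (Sum.inl i) ∉ S ∪ S' := fun i hi h =>
    h.elim (hSw i) (hstar _ (inl_mem_star.2 hi))
  obtain ⟨e, he, hcut⟩ := exists_full_of_cut (hB.2 S hS S' hS') (fun a => a = Sum.inr j)
    (Or.inl hjS) (Or.inr haS') rfl haj
  have h1 := he.src_mem
  have h2 := he.tgt_mem
  rcases e with (i | k) | ⟨_ | k, i, q⟩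
  · simp [bundledCycle] at hcut
  · simp only [bundledCycle, Sum.inr.injEq, reduceCtorEq, iff_false, not_not] at hcut h2
    subst hcut
    exact hw _ (by simp) h2
  · simp [bundledCycle, farEnd] at hcut
  · simp only [bundledCycle, farEnd, Sum.inr.injEq, reduceCtorEq, iff_false, not_not] at hcut h2
    subst hcut
    refine hw _ ?_ h2
    split_ifs with h
    · simp
    · exact h

end
section

open LengthMultigraph

variable {n : ℕ} {hn : 0 < n}

theorem not_full_far {S : Set (bundledCycle n hn).Vertex}
    (hS : IsConnSet (bundledCycle n hn).subdivision S) (hcard : S.ncard ≤ 6 * n) {j : Fin 6}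
    (hj : ∀ a ∈ starBranch j, Sum.inl a ∈ S) (x : Branch × Fin 6 × Fin (6 * n + 1)) :
    ¬ (bundledCycle n hn).Full S (Sum.inr x) := by
  intro hx
  set e : Branch ⊕ (Branch × Fin 6 × Fin (6 * n + 1)) := Sum.inr x with he
  obtain ⟨a, ha, hae⟩ : ∃ a ∈ starBranch j,
      a ∉ ({(bundledCycle n hn).src e, (bundledCycle n hn).tgt e} : Finset Branch) := by
    refine Finset.exists_mem_notMem_of_card_lt_card (Finset.card_le_two.trans_lt ?_)
    simp [card_star]
  simp only [Finset.mem_insert, Finset.mem_singleton, not_or] at hae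
  obtain ⟨e', he', hcut⟩ := exists_full_of_cut hS (fun b => b = a) (hj a ha) hx.src_mem rfl
    (Ne.symm hae.1)
  have hne : e ≠ e' := by
    rintro rfl
    exact hcut (iff_of_false (Ne.symm hae.1) (Ne.symm hae.2))
  have := card_span_le_ncard (E' := {e, e'}) hj (by
    simp only [Finset.mem_insert, Finset.mem_singleton, forall_eq_or_imp, forall_eq]
    exact ⟨hx, he'⟩)
  rw [card_star, Finset.sum_pair hne] at this
  have h1 : (bundledCycle n hn).len e = 5 * n + 2 := rfl
  have h2 := sub_one_le_len_sub_one (hn := hn) e'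
  omega

theorem sum_len_cycle :
    ∑ i : Fin 6, ((bundledCycle n hn).len (Sum.inl (Sum.inl i)) - 1) + 6 = 6 * n + 1 := by
  rw [Fin.sum_univ_six]
  simp [bundledCycle]
  omega

theorem full_arc_of_not_full_arc {S : Set (bundledCycle n hn).Vertex}
    (hS : IsConnSet (bundledCycle n hn).subdivision S)
    (hfar : ∀ x, ¬ (bundledCycle n hn).Full S (Sum.inr x)) {i i' : Fin 6} (hne : i' ≠ i)
    (h1 : Sum.inl (Sum.inl i) ∈ S) (h2 : Sum.inl (Sum.inl (i + 1)) ∈ S)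
    (hi : ¬ (bundledCycle n hn).Full S (Sum.inl (Sum.inl i))) :
    (bundledCycle n hn).Full S (Sum.inl (Sum.inl i')) := by
  obtain ⟨e, he, hcut⟩ := exists_full_of_cut hS
    (fun a => Sum.elim id (fun k => k + 3) a - (i + 1) ≤ i' - (i + 1)) h2 h1
    (by simp) (by
      simp only [Sum.elim_inl, id_eq]
      clear * - hne
      decide +revert)
  rcases e with (k | k) | x
  · have hki : k ≠ i := by
      rintro rfl
      exact hi he
    simp only [bundledCycle, Sum.elim_inl, id_eq] at hcut
    have : k = i' := by
      clear * - hki hne hcut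
      decide +revert
    exact this ▸ he
  · exact absurd Iff.rfl hcut
  · exact absurd he (hfar x)

theorem full_arc {S : Set (bundledCycle n hn).Vertex}
    (hS : IsConnSet (bundledCycle n hn).subdivision S) (hcard : S.ncard ≤ 6 * n) {j : Fin 6}
    (hj : ∀ a ∈ starBranch j, Sum.inl a ∈ S) {i : Fin 6} (hij : i ≠ j) (hij' : i + 1 ≠ j) :
    (bundledCycle n hn).Full S (Sum.inl (Sum.inl i)) := by
  have hfar := not_full_far hS hcard hj
  by_contra hi
  have harc : ∀ i', i' ≠ i → (bundledCycle n hn).Full S (Sum.inl (Sum.inl i')) := fun i' hne =>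
    full_arc_of_not_full_arc hS hfar hne (hj _ (inl_mem_star.2 hij)) (hj _ (inl_mem_star.2 hij')) hi
  have hleg : (bundledCycle n hn).Full S (Sum.inl (Sum.inr j)) := by
    obtain ⟨e, he, hcut⟩ := exists_full_of_cut hS (fun a => a = Sum.inr j)
      (hj _ (inr_mem_star.2 rfl)) (hj _ (inl_mem_star.2 hij)) rfl (by simp)
    rcases e with (k | k) | x
    · simp [bundledCycle] at hcut
    · simp only [bundledCycle, Sum.inr.injEq, reduceCtorEq, iff_false, not_not] at hcut
      exact hcut ▸ he
    · exact absurd he (hfar x)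
  have := card_span_le_ncard (S := S) (A' := insert (Sum.inl j) (starBranch j))
    (E' := insert (Sum.inl (Sum.inr j))
      ((Finset.univ.erase i).image fun k => Sum.inl (Sum.inl k))) (by
      simp only [Finset.forall_mem_insert]
      exact ⟨(harc j hij.symm).src_mem, hj⟩) (by
      simp only [Finset.forall_mem_insert, Finset.forall_mem_image]
      exact ⟨hleg, fun k hk => harc k (Finset.ne_of_mem_erase hk)⟩)
  rw [Finset.card_insert_of_notMem (by simp [inl_mem_star]), card_star,
    Finset.sum_insert (by simp), Finset.sum_image (by simp)] at this
  have h2 : 5 * (n - 1) ≤ ∑ k ∈ Finset.univ.erase i,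
      ((bundledCycle n hn).len (Sum.inl (Sum.inl k)) - 1) := by
    simpa using Finset.card_nsmul_le_sum (Finset.univ.erase i)
      (fun k => (bundledCycle n hn).len (Sum.inl (Sum.inl k)) - 1) (n - 1)
      fun k _ => sub_one_le_len_sub_one _
  have h3 := sub_one_le_len_sub_one (hn := hn) (Sum.inl (Sum.inr j))
  omega

theorem exists_bag_of_star {ι : Type} {T : SimpleGraph ι}
    (td : TreeDecomp (bundledCycle n hn).subdivision T) (hcard : ∀ t, (td.bag t).ncard ≤ 6 * n)
    (j : Fin 6) : ∃ t, ∀ a ∈ starBranch j, Sum.inl a ∈ td.bag t := by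
  have hpar : ∀ a i, ∃ t, Sum.inl a ∈ td.bag t ∧ Sum.inl (farEnd a i) ∈ td.bag t := fun a i =>
    exists_bag_of_parallel td hcard (es := fun q => Sum.inr (a, i, q))
      (fun q q' h => by simpa using h) (fun _ => rfl) fun _ => rfl
  refine PathConvex.exists_mem_forall td.isTree.connected (starBranch j)
    (fun a => {t | Sum.inl a ∈ td.bag t}) (fun a _ => td.pathConvex_mem _) ?_
  rintro (i | i) hi (i' | i') hi'
  · exact hpar (Sum.inl i) i'
  · obtain ⟨t, ht⟩ := hpar (Sum.inr i') i
    rw [inr_mem_star] at hi'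
    rw [farEnd, if_neg (hi' ▸ inl_mem_star.1 hi)] at ht
    exact ⟨t, ht.symm⟩
  · obtain ⟨t, ht⟩ := hpar (Sum.inr i) i'
    rw [inr_mem_star] at hi
    rw [farEnd, if_neg (hi ▸ inl_mem_star.1 hi')] at ht
    exact ⟨t, ht⟩
  · obtain rfl := inr_mem_star.1 hi
    obtain rfl := inr_mem_star.1 hi'
    obtain ⟨t, ht⟩ := td.exists_bag (Sum.inl (Sum.inr i'))
    exact ⟨t, ht, ht⟩

theorem exists_lt_ncard_bag {ι : Type} {T : SimpleGraph ι}
    (td : TreeDecomp (bundledCycle n hn).subdivision T) (hconn : td.IsConn) :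
    ∃ t, 6 * n < (td.bag t).ncard := by
  by_contra! hcard
  have harcs : ∀ i i' : Fin 6, ∃ t, (bundledCycle n hn).Full (td.bag t) (Sum.inl (Sum.inl i)) ∧
      (bundledCycle n hn).Full (td.bag t) (Sum.inl (Sum.inl i')) := by
    intro i i'
    obtain ⟨j, h1, h2, h3, h4⟩ : ∃ j, i ≠ j ∧ i + 1 ≠ j ∧ i' ≠ j ∧ i' + 1 ≠ j := by
      decide +revert
    obtain ⟨t, ht⟩ := exists_bag_of_star td hcard j
    exact ⟨t, full_arc (hconn t) (hcard t) ht h1 h2, full_arc (hconn t) (hcard t) ht h3 h4⟩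
  obtain ⟨t, ht⟩ := PathConvex.exists_mem_forall td.isTree.connected
    (Finset.univ.sigma fun i : Fin 6 =>
      Finset.range ((bundledCycle n hn).len (Sum.inl (Sum.inl i)) + 1))
    (fun x => {t | (bundledCycle n hn).pt (Sum.inl (Sum.inl x.1)) x.2 ∈ td.bag t})
    (fun _ _ => td.pathConvex_mem _) (by
      rintro ⟨i, k⟩ hk ⟨i', k'⟩ hk'
      simp only [Finset.mem_sigma, Finset.mem_univ, Finset.mem_range, true_and,
        Nat.lt_succ_iff] at hk hk'
      obtain ⟨t, h1, h2⟩ := harcs i i'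
      exact ⟨t, h1 k hk, h2 k' hk'⟩)
  have hfull : ∀ i, (bundledCycle n hn).Full (td.bag t) (Sum.inl (Sum.inl i)) := fun i k hk =>
    ht ⟨i, k⟩ (by simpa [Nat.lt_succ_iff] using hk)
  have := card_span_le_ncard (S := td.bag t) (A' := Finset.univ.image Sum.inl)
    (E' := Finset.univ.image fun i => Sum.inl (Sum.inl i))
    (by
      simp only [Finset.forall_mem_image]
      exact fun i _ => (hfull i).src_mem)
    (by
      simp only [Finset.forall_mem_image]
      exact fun i _ => hfull i)
  rw [Finset.card_image_of_injective _ Sum.inl_injective,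
    Finset.sum_image fun i _ i' _ h => Sum.inl_injective (Sum.inl_injective h), Finset.card_univ,
    Fintype.card_fin] at this
  have h1 := sum_len_cycle (hn := hn)
  have h2 := hcard t
  omega

theorem isConnSet_univ_bundledCycle :
    IsConnSet (bundledCycle n hn).subdivision Set.univ := by
  have h := isConnSet_span (M := bundledCycle n hn) (A' := Finset.univ) (E' := Finset.univ)
    (r := Sum.inl 0) (by simp) (by simp) (by simp) (by
      intro P h0 hP a _
      have hfar : ∀ a i, P a ↔ P (farEnd a i) := fun a i =>
        hP (Sum.inr (a, i, 0)) (Finset.mem_univ _)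
      have hw : ∀ i, P (Sum.inl i) := fun i => (hfar _ i).1 h0
      rcases a with i | i
      · exact hw i
      · exact (hfar _ 0).2 (hw _))
  convert h
  ext (x | x) <;> simp

theorem exists_treeDecomp_isConn {V : Type} {G : SimpleGraph V} (hG : IsConnSet G Set.univ) :
    ∃ (ι : Type) (T : SimpleGraph ι) (td : TreeDecomp G T), td.IsConn ∧
      ∀ t, (td.bag t).ncard ≤ (Set.univ : Set V).ncard :=
  ⟨Unit, ⊥, {
    isTree := .of_subsingleton
    bag := fun _ => Set.univ
    exists_bag := fun _ => ⟨(), trivial⟩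
    exists_bag_adj := fun _ _ _ => ⟨(), trivial, trivial⟩
    bag_sep := fun _ _ _ _ _ _ => Set.subset_univ _ }, fun _ => hG, fun _ => le_rfl⟩

theorem le_ctw_bundledCycle : 6 * n ≤ ctw (bundledCycle n hn).subdivision := by
  obtain ⟨ι, T, td, hconn, hcard⟩ :=
    exists_treeDecomp_isConn (isConnSet_univ_bundledCycle (hn := hn))
  rw [ctw]
  refine le_csInf ⟨_, ι, T, td, hconn, fun t => (hcard t).trans (Nat.le_succ _)⟩ ?_
  rintro k ⟨ι, T, td, hconn, hk⟩
  obtain ⟨t, ht⟩ := exists_lt_ncard_bag td hconn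
  have := hk t
  omega

end

theorem cbn_le {V : Type} {G : SimpleGraph V} {m : ℕ}
    (h : ∀ B, IsBramble G B → ∃ X, IsConnCover G B X ∧ X.ncard ≤ m) : cbn G ≤ m := by
  refine csSup_le' ?_
  rintro _ ⟨B, hB, rfl⟩
  obtain ⟨X, hX, hXm⟩ := h B hB
  have : connOrder G B ≤ X.ncard := Nat.sInf_le ⟨X, hX, rfl⟩
  exact this.trans hXm

/-- connected tree-width duality fails: there is a graph whose
connected tree-width exceeds the maximum connected bramble order minus one;
more specifically, for every `n ≥ 4` there is a (finite) graph in which every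
bramble has connected order at most `5n + 3` while the connected tree-width is
at least `6n`. -/
theorem duality_fails :
    (∃ (V : Type) (G : SimpleGraph V), Finite V ∧ cbn G - 1 < ctw G) ∧
    ∀ n : ℕ, 4 ≤ n → ∃ (V : Type) (G : SimpleGraph V), Finite V ∧
      (∀ B, IsBramble G B → ∃ X, IsConnCover G B X ∧ X.ncard ≤ 5 * n + 3) ∧
      6 * n ≤ ctw G := by
  have key : ∀ n : ℕ, 4 ≤ n → ∃ (V : Type) (G : SimpleGraph V), Finite V ∧
      (∀ B, IsBramble G B → ∃ X, IsConnCover G B X ∧ X.ncard ≤ 5 * n + 3) ∧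
      6 * n ≤ ctw G := fun n h4 =>
    ⟨_, (bundledCycle n (by omega)).subdivision, inferInstance,
      fun B hB => exists_isConnCover h4 hB, le_ctw_bundledCycle⟩
  refine ⟨?_, key⟩
  obtain ⟨V, G, hV, hB, hG⟩ := key 4 le_rfl
  have := cbn_le hB
  exact ⟨V, G, hV, by omega⟩
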